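/- With h₀ := 4ξ₂ − 2ξ₃ − 2ξ₄ and h₁ := 2ξ₃ − 2ξ₄, the Wronskian identity h₀·∂₂h₁ − h₁·∂₂h₀ = 4·η¹² holds at every point of ℍ. -/

import Mathlib

open Complex

noncomputable section

/-- `q = e^{2πiτ}`. -/
def qexp (τ : ℂ) : ℂ := Complex.exp (2 * ↑Real.pi * Complex.I * τ)

/-- `q^s = e^{2πisτ}` for real `s`. -/
def qpow (s : ℝ) (τ : ℂ) : ℂ := Complex.exp (2 * ↑Real.pi * Complex.I * ↑s * τ)

/-- The differential operator `f' = (1/(2πi)) df/dτ` (i.e. `q d/dq`). -/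
def Dq (f : ℂ → ℂ) : ℂ → ℂ := fun τ => deriv f τ / (2 * ↑Real.pi * Complex.I)

/-- The divisor power sum `σ_k(n)`. -/
def sigma' (k n : ℕ) : ℕ := ∑ d ∈ n.divisors, d ^ k

/-- The quasimodular Eisenstein series `E₂`. -/
def E2 (τ : ℂ) : ℂ := 1 - 24 * ∑' n : ℕ, (sigma' 1 (n + 1) : ℂ) * qexp τ ^ (n + 1)

/-- The Eisenstein series `E₄`. -/
def E4 (τ : ℂ) : ℂ := 1 + 240 * ∑' n : ℕ, (sigma' 3 (n + 1) : ℂ) * qexp τ ^ (n + 1)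

/-- The Eisenstein series `E₆`. -/
def E6 (τ : ℂ) : ℂ := 1 - 504 * ∑' n : ℕ, (sigma' 5 (n + 1) : ℂ) * qexp τ ^ (n + 1)

/-- The Dedekind eta function `η(τ) = q^{1/24} ∏ (1 - qⁿ)`. -/
def η (τ : ℂ) : ℂ := qpow (1/24) τ * ∏' n : ℕ, (1 - qexp τ ^ (n + 1))

/-- Theta constant `θ₂(τ) = Σ_{n∈ℤ} q^{(n-1/2)²/2}`. -/
def θ₂ (τ : ℂ) : ℂ := ∑' n : ℤ, qpow (((n : ℝ) - 1/2) ^ 2 / 2) τ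

/-- Theta constant `θ₃(τ) = Σ_{n∈ℤ} q^{n²/2}`. -/
def θ₃ (τ : ℂ) : ℂ := ∑' n : ℤ, qpow ((n : ℝ) ^ 2 / 2) τ

/-- Theta constant `θ₄(τ) = Σ_{n∈ℤ} (-1)ⁿ q^{n²/2}`. -/
def θ₄ (τ : ℂ) : ℂ := ∑' n : ℤ, (-1 : ℂ) ^ n * qpow ((n : ℝ) ^ 2 / 2) τ

/-- `ξ₂ = 2 θ₂'/θ₂`. -/
def ξ₂ : ℂ → ℂ := fun τ => 2 * Dq θ₂ τ / θ₂ τ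

/-- `ξ₃ = 2 θ₃'/θ₃`. -/
def ξ₃ : ℂ → ℂ := fun τ => 2 * Dq θ₃ τ / θ₃ τ

/-- `ξ₄ = 2 θ₄'/θ₄`. -/
def ξ₄ : ℂ → ℂ := fun τ => 2 * Dq θ₄ τ / θ₄ τ

/-- `h₀ = 4ξ₂ - 2ξ₃ - 2ξ₄` (equal to `η⁴ χ_{Λ₀}^{q}`). -/
def h₀ : ℂ → ℂ := fun τ => 4 * ξ₂ τ - 2 * ξ₃ τ - 2 * ξ₄ τ

/-- `h₁ = 2ξ₃ - 2ξ₄` (equal to `η⁴ χ_{Λ₁}^{q}`). -/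
def h₁ : ℂ → ℂ := fun τ => 2 * ξ₃ τ - 2 * ξ₄ τ

/-- The Serre-type derivative `∂_k f = f' - (k/12) E₂ f`. -/
def partialD (k : ℂ) (f : ℂ → ℂ) : ℂ → ℂ := fun τ => Dq f τ - k / 12 * E2 τ * f τ

end

open Filter Topology

open UpperHalfPlane hiding I

lemma summable_pow_of_le {e : ℕ → ℕ} (he : ∀ n, n ≤ e n) {x : ℂ} (hx : ‖x‖ < 1) :
    Summable fun n ↦ x ^ e n := by
  refine .of_norm_bounded (summable_geometric_of_lt_one (norm_nonneg x) hx) fun n ↦ ?_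
  rw [norm_pow]
  exact pow_le_pow_of_le_one (norm_nonneg x) hx.le (he n)

lemma differentiableOn_tsum_pow_of_le {e : ℕ → ℕ} (he : ∀ n, n ≤ e n) :
    DifferentiableOn ℂ (fun x ↦ ∑' n, x ^ e n) (Metric.ball (0 : ℂ) 1) := by
  intro x hx
  obtain ⟨r, hxr, hr⟩ := exists_between (mem_ball_zero_iff.mp hx)
  have hr0 : 0 ≤ r := (norm_nonneg x).trans hxr.le
  refine ((Complex.differentiableOn_tsum_of_summable_norm
    (summable_geometric_of_lt_one hr0 hr) (fun n ↦ by fun_prop) Metric.isOpen_ball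
    fun n w hw ↦ ?_).differentiableAt
      (Metric.isOpen_ball.mem_nhds (mem_ball_zero_iff.mpr hxr))).differentiableWithinAt
  have hw' := (mem_ball_zero_iff.mp hw).le
  rw [norm_pow]
  exact (pow_le_pow_left₀ (norm_nonneg w) hw' _).trans (pow_le_pow_of_le_one hr0 hr.le (he n))

/-- The nome `x = e^{πiτ}`, so that `x ^ 2 = q`. -/
noncomputable def nome (τ : ℂ) : ℂ := cexp (Real.pi * I * τ)

/-- The series `∑_{n ∈ ℤ} x ^ (n ^ 2)`. -/
noncomputable def thetaSeries (x : ℂ) : ℂ := 1 + 2 * x * ∑' n : ℕ, x ^ (n * (n + 2))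

/-- The series `∑_{n ∈ ℤ} x ^ (n * (n - 1))`. -/
noncomputable def psiSeries (x : ℂ) : ℂ := 2 * ∑' n : ℕ, x ^ (n * (n + 1))

lemma norm_nome_lt_one {τ : ℂ} (hτ : 0 < τ.im) : ‖nome τ‖ < 1 := by
  rw [nome, Complex.norm_exp, Real.exp_lt_one_iff]
  simpa using mul_pos Real.pi_pos hτ

lemma hasDerivAt_nome (τ : ℂ) : HasDerivAt nome (Real.pi * I * nome τ) τ := by
  have := ((hasDerivAt_id τ).const_mul (Real.pi * I)).cexp
  change HasDerivAt (fun t ↦ cexp (Real.pi * I * t)) (Real.pi * I * cexp (Real.pi * I * τ)) τ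
  simpa [mul_comm] using this

lemma nome_ne_zero (τ : ℂ) : nome τ ≠ 0 := Complex.exp_ne_zero _

lemma nome_sq (τ : ℂ) : nome τ ^ 2 = qexp τ := by
  rw [nome, qexp, ← Complex.exp_nat_mul]
  congr 1
  push_cast
  ring

lemma nome_add_one (τ : ℂ) : nome (τ + 1) = -nome τ := by
  rw [nome, nome, mul_add, mul_one, Complex.exp_add, Complex.exp_pi_mul_I, mul_neg_one]

lemma tendsto_nome_atTop : Tendsto (fun y : ℝ ↦ nome (y * I)) atTop (𝓝 0) := by
  rw [tendsto_zero_iff_norm_tendsto_zero]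
  have h : (fun y : ℝ ↦ ‖nome (y * I)‖) = fun y ↦ Real.exp (-(Real.pi * y)) := by
    ext y
    simp [nome, Complex.norm_exp]
  rw [h]
  exact Real.tendsto_exp_neg_atTop_nhds_zero.comp (tendsto_id.const_mul_atTop Real.pi_pos)

lemma differentiableOn_thetaSeries : DifferentiableOn ℂ thetaSeries (Metric.ball (0 : ℂ) 1) := by
  have := differentiableOn_tsum_pow_of_le (e := fun n ↦ n * (n + 2)) fun n ↦ by nlinarith
  unfold thetaSeries
  fun_prop

lemma differentiableOn_psiSeries : DifferentiableOn ℂ psiSeries (Metric.ball (0 : ℂ) 1) := by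
  have := differentiableOn_tsum_pow_of_le (e := fun n ↦ n * (n + 1)) fun n ↦ by nlinarith
  unfold psiSeries
  fun_prop

lemma thetaSeries_zero : thetaSeries 0 = 1 := by simp [thetaSeries]

lemma psiSeries_zero : psiSeries 0 = 2 := by
  rw [psiSeries, tsum_eq_single 0 fun n hn ↦ by simp [hn]]
  simp

lemma deriv_thetaSeries_zero : deriv thetaSeries 0 = 2 := by
  have h := (differentiableOn_tsum_pow_of_le (e := fun n ↦ n * (n + 2))
    fun n ↦ by nlinarith).differentiableAt (Metric.ball_mem_nhds 0 one_pos)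
  have h0 : ∑' n : ℕ, (0 : ℂ) ^ (n * (n + 2)) = 1 := by
    rw [tsum_eq_single 0 fun n hn ↦ by simp [hn]]
    simp
  have := ((((hasDerivAt_id (0 : ℂ)).const_mul 2).mul h.hasDerivAt).const_add 1).deriv
  change deriv (fun x ↦ 1 + 2 * x * ∑' n : ℕ, x ^ (n * (n + 2))) 0 = 2
  simpa [h0, Pi.mul_def] using this

lemma hasSum_thetaSeries {x : ℂ} (hx : ‖x‖ < 1) :
    HasSum (fun n : ℤ ↦ x ^ (n.natAbs ^ 2)) (thetaSeries x) := by
  have h := ((summable_pow_of_le (e := fun n ↦ n * (n + 2))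
    (fun n ↦ by nlinarith) hx).hasSum).mul_left x
  have h' : HasSum (fun n : ℕ ↦ x ^ ((n + 1) ^ 2)) (x * ∑' n : ℕ, x ^ (n * (n + 2))) := by
    refine h.congr_fun fun n ↦ ?_
    rw [← pow_succ']
    ring_nf
  have := HasSum.of_add_one_of_neg_add_one (f := fun n : ℤ ↦ x ^ (n.natAbs ^ 2))
    (h'.congr_fun fun n ↦ by norm_cast) (h'.congr_fun fun n ↦ by rw [Int.natAbs_neg]; norm_cast)
  convert! this using 1
  simp [thetaSeries]
  ring

lemma θ₃_eq_thetaSeries {τ : ℂ} (hτ : 0 < τ.im) : θ₃ τ = thetaSeries (nome τ) := by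
  rw [← (hasSum_thetaSeries (norm_nome_lt_one hτ)).tsum_eq, θ₃]
  refine tsum_congr fun n ↦ ?_
  rw [qpow, nome, ← Complex.exp_nat_mul]
  congr 1
  rw [← Int.cast_natCast (R := ℂ) (n.natAbs ^ 2), Nat.cast_pow, Int.natAbs_sq]
  push_cast
  ring

lemma θ₄_eq_thetaSeries {τ : ℂ} (hτ : 0 < τ.im) : θ₄ τ = thetaSeries (-nome τ) := by
  rw [← (hasSum_thetaSeries (by simpa using norm_nome_lt_one hτ)).tsum_eq, θ₄]
  refine tsum_congr fun n ↦ ?_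
  rw [qpow, neg_pow, nome, ← Complex.exp_nat_mul]
  congr 1
  · rcases Int.even_or_odd n with h | h
    · rw [h.neg_one_zpow, ((Int.natAbs_even.mpr h).pow_of_ne_zero two_ne_zero).neg_one_pow]
    · rw [h.neg_one_zpow, ((Int.natAbs_odd.mpr h).pow).neg_one_pow]
  · congr 1
    rw [← Int.cast_natCast (R := ℂ) (n.natAbs ^ 2), Nat.cast_pow, Int.natAbs_sq]
    push_cast
    ring

lemma θ₂_eq_psiSeries {τ : ℂ} (hτ : 0 < τ.im) :
    θ₂ τ = cexp (Real.pi * I * τ / 4) * psiSeries (nome τ) := by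
  have h := (summable_pow_of_le (e := fun n ↦ n * (n + 1))
    (fun n ↦ by nlinarith) (norm_nome_lt_one hτ)).hasSum.mul_left (cexp (Real.pi * I * τ / 4))
  have key (a : ℤ) (n : ℕ) (ha : (a : ℂ) * (a - 1) = n * (n + 1)) :
      qpow (((a : ℝ) - 1 / 2) ^ 2 / 2) τ =
        cexp (Real.pi * I * τ / 4) * nome τ ^ (n * (n + 1)) := by
    rw [qpow, nome, ← Complex.exp_nat_mul, ← Complex.exp_add]
    congr 1
    push_cast
    linear_combination (Real.pi * I * τ) * ha
  have := HasSum.of_nat_of_neg_add_one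
    (f := fun a : ℤ ↦ qpow ((((a + 1 : ℤ) : ℝ) - 1 / 2) ^ 2 / 2) τ)
    (h.congr_fun fun n ↦ key _ n (by push_cast; ring))
    (h.congr_fun fun n ↦ key _ n (by push_cast; ring))
  rw [θ₂, ((Equiv.addRight (1 : ℤ)).hasSum_iff
    (f := fun a : ℤ ↦ qpow (((a : ℝ) - 1 / 2) ^ 2 / 2) τ)).mp this |>.tsum_eq, psiSeries]
  ring

lemma psiSeries_neg (x : ℂ) : psiSeries (-x) = psiSeries x := by
  simp_rw [psiSeries, fun n : ℕ ↦ (Nat.even_mul_succ_self n).neg_pow x]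

lemma θ₃_add_one {τ : ℂ} (hτ : 0 < τ.im) : θ₃ (τ + 1) = θ₄ τ := by
  rw [θ₃_eq_thetaSeries (by simpa using hτ), θ₄_eq_thetaSeries hτ, nome_add_one]

lemma θ₄_add_one {τ : ℂ} (hτ : 0 < τ.im) : θ₄ (τ + 1) = θ₃ τ := by
  rw [θ₄_eq_thetaSeries (by simpa using hτ), θ₃_eq_thetaSeries hτ, nome_add_one, neg_neg]

lemma θ₂_add_one {τ : ℂ} (hτ : 0 < τ.im) :
    θ₂ (τ + 1) = cexp (Real.pi * I / 4) * θ₂ τ := by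
  rw [θ₂_eq_psiSeries (by simpa using hτ), θ₂_eq_psiSeries hτ, nome_add_one, psiSeries_neg,
    ← mul_assoc, ← Complex.exp_add]
  ring_nf

lemma θ₃_eq_jacobiTheta₂ (τ : ℂ) : θ₃ τ = jacobiTheta₂ 0 τ := by
  refine tsum_congr fun n ↦ ?_
  rw [qpow, jacobiTheta₂_term]
  congr 1
  push_cast
  ring

lemma θ₄_eq_jacobiTheta₂ (τ : ℂ) : θ₄ τ = jacobiTheta₂ (1 / 2) τ := by
  refine tsum_congr fun n ↦ ?_
  rw [qpow, jacobiTheta₂_term, Complex.exp_add, ← Complex.exp_pi_mul_I, ← Complex.exp_int_mul]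
  congr 2
  · ring
  · push_cast
    ring

lemma θ₂_eq_jacobiTheta₂ (τ : ℂ) :
    θ₂ τ = cexp (Real.pi * I * τ / 4) * jacobiTheta₂ (-τ / 2) τ := by
  rw [θ₂, jacobiTheta₂, ← tsum_mul_left]
  refine tsum_congr fun n ↦ ?_
  rw [qpow, jacobiTheta₂_term, ← Complex.exp_add]
  congr 1
  push_cast
  ring

/-- The automorphy factor of the theta constants under `τ ↦ -1 / τ`. -/
noncomputable def thetaFactor (τ : ℂ) : ℂ := (-I * τ) ^ (1 / 2 : ℂ)

lemma ne_zero_of_im_pos {τ : ℂ} (hτ : 0 < τ.im) : τ ≠ 0 := by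
  rintro rfl
  simp at hτ

lemma im_neg_one_div_pos {τ : ℂ} (hτ : 0 < τ.im) : 0 < (-1 / τ).im := by
  rw [neg_div, neg_im, one_div, inv_im, neg_div, neg_neg]
  exact div_pos hτ (normSq_pos.mpr (ne_zero_of_im_pos hτ))

lemma thetaFactor_ne_zero {τ : ℂ} (hτ : 0 < τ.im) : thetaFactor τ ≠ 0 := by
  simp [thetaFactor, cpow_eq_zero_iff, ne_zero_of_im_pos hτ]

lemma thetaFactor_pow {τ : ℂ} : thetaFactor τ ^ 24 = τ ^ 12 := by
  have h : thetaFactor τ ^ 2 = -I * τ := by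
    rw [thetaFactor, ← cpow_nat_mul]
    norm_num
  rw [show 24 = 2 * 12 by norm_num, pow_mul, h, mul_pow, neg_pow, show 12 = 4 * 3 by norm_num,
    pow_mul I, I_pow_four]
  norm_num

lemma differentiableAt_thetaFactor {τ : ℂ} (hτ : 0 < τ.im) :
    DifferentiableAt ℂ thetaFactor τ := by
  have : -I * τ ∈ slitPlane := by simp [mem_slitPlane_iff, hτ]
  unfold thetaFactor
  fun_prop (disch := assumption)

lemma θ₃_neg_one_div {τ : ℂ} (hτ : 0 < τ.im) : θ₃ (-1 / τ) = thetaFactor τ * θ₃ τ := by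
  rw [θ₃_eq_jacobiTheta₂ τ, jacobiTheta₂_functional_equation, θ₃_eq_jacobiTheta₂, ← thetaFactor]
  have := thetaFactor_ne_zero hτ
  field_simp
  simp

lemma θ₂_neg_one_div {τ : ℂ} (hτ : 0 < τ.im) : θ₂ (-1 / τ) = thetaFactor τ * θ₄ τ := by
  rw [θ₄_eq_jacobiTheta₂ τ, jacobiTheta₂_functional_equation, θ₂_eq_jacobiTheta₂, ← thetaFactor]
  have := thetaFactor_ne_zero hτ
  have h0 := ne_zero_of_im_pos hτ
  rw [← mul_assoc, ← mul_assoc, mul_one_div_cancel this, one_mul]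
  congr 2
  · ring
  · ring

lemma θ₄_neg_one_div {τ : ℂ} (hτ : 0 < τ.im) : θ₄ (-1 / τ) = thetaFactor τ * θ₂ τ := by
  rw [θ₂_eq_jacobiTheta₂ τ, jacobiTheta₂_functional_equation, θ₄_eq_jacobiTheta₂, ← thetaFactor]
  have := thetaFactor_ne_zero hτ
  have h0 := ne_zero_of_im_pos hτ
  have h1 : -τ / 2 / τ = -(1 / 2) := by field_simp
  have h2 : -Real.pi * I * (-τ / 2) ^ 2 / τ = -(Real.pi * I * τ / 4) := by field_simp; ring
  rw [h1, jacobiTheta₂_neg_left, h2, Complex.exp_neg]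
  field_simp

/-- The Euler product `∏ (1 - qⁿ)`. -/
noncomputable def eulerProd (q : ℂ) : ℂ := ∏' n : ℕ, (1 - q ^ (n + 1))

lemma tendsto_eulerProd : Tendsto eulerProd (𝓝 0) (𝓝 1) := by
  have := (ModularForm.differentiableOn_tprod_one_sub_pow.differentiableAt
    (Metric.ball_mem_nhds 0 one_pos)).continuousAt.tendsto
  change Tendsto (fun q ↦ ∏' n : ℕ, (1 - q ^ (n + 1))) (𝓝 0) (𝓝 1)
  simpa using this

lemma η_pow_twelve (τ : ℂ) : η τ ^ 12 = nome τ * eulerProd (nome τ ^ 2) ^ 12 := by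
  rw [η, mul_pow, eulerProd, nome_sq, qpow, ← Complex.exp_nat_mul, nome]
  congr 2
  push_cast
  ring

lemma η_eq_eta (τ : ℂ) : η τ = ModularForm.eta τ := by
  simp only [η, ModularForm.eta, ModularForm.eta_q_eq_pow, qexp, qpow, Function.Periodic.qParam]
  congr 2
  push_cast
  ring

lemma η_ne_zero {τ : ℂ} (hτ : 0 < τ.im) : η τ ≠ 0 :=
  η_eq_eta τ ▸ ModularForm.eta_ne_zero hτ

open scoped MatrixGroups in
/-- A holomorphic function on the upper half-plane with the transformation behaviour of a modular
form of weight `12` and level one, and with a simple zero in `q` at infinity, is a multiple of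
`η ^ 24`. -/
lemma eq_const_mul_η_pow {F V : ℂ → ℂ} (hd : ∀ τ : ℂ, 0 < τ.im → DifferentiableAt ℂ F τ)
    (hT : ∀ τ : ℂ, 0 < τ.im → F (τ + 1) = F τ)
    (hS : ∀ τ : ℂ, 0 < τ.im → F (-1 / τ) = τ ^ 12 * F τ)
    (hV : ContinuousAt V 0) (hF : ∀ τ : ℂ, 0 < τ.im → F τ = nome τ ^ 2 * V (nome τ))
    {τ : ℂ} (hτ : 0 < τ.im) : F τ = V 0 * η τ ^ 24 := by
  set f : ℍ → ℂ := fun z ↦ F z with hf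
  have hfT : SlashAction.map (12 : ℤ) ModularGroup.T f = f := by
    ext z
    rw [ModularForm.SL_slash_apply, modular_T_smul, ModularGroup.denom_apply]
    simpa [hf, add_comm, ModularGroup.coe_T] using hT z z.2
  have hfS : SlashAction.map (12 : ℤ) ModularGroup.S f = f := by
    ext z
    have h0 := ne_zero_of_im_pos z.2
    rw [ModularForm.SL_slash_apply, modular_S_smul, ModularGroup.denom_S]
    have := hS z z.2
    suffices F (-(z : ℂ)⁻¹) * ((z : ℂ) ^ 12)⁻¹ = F z by
      simpa [hf]
    rw [← one_div, ← neg_div, this]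
    field_simp
  have hf0 : IsZeroAtImInfty f := by
    have h1 : Tendsto (fun z : ℍ ↦ nome z) atImInfty (𝓝 0) := by
      have := UpperHalfPlane.qParam_tendsto_atImInfty (h := 2) two_pos
      refine this.congr fun z ↦ ?_
      rw [Function.Periodic.qParam, nome]
      congr 1
      push_cast
      ring
    have h2 := (h1.pow 2).mul (hV.tendsto.comp h1)
    rw [zero_pow two_ne_zero, zero_mul] at h2
    exact h2.congr fun z ↦ (hF z z.2).symm
  let G : CuspForm 𝒮ℒ 12 :=
    { toFun := f
      slash_action_eq' := fun A hA ↦ by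
        obtain ⟨A, rfl⟩ := hA
        exact SlashInvariantForm.slash_action_generators_SL2Z hfS hfT A
      holo' := by
        rw [UpperHalfPlane.mdifferentiable_iff]
        refine .congr (fun z hz ↦ (hd z hz).differentiableWithinAt) fun z hz ↦ ?_
        simp [hf, ofComplex_apply_of_im_pos hz]
      zero_at_cusps' := fun hc ↦ by
        rw [Subgroup.IsArithmetic.isCusp_iff_isCusp_SL2Z] at hc
        rw [OnePoint.isZeroAt_iff_forall_SL2Z hc]
        intro γ _
        rw [SlashInvariantForm.slash_action_generators_SL2Z hfS hfT]
        exact hf0 }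
  obtain ⟨c, hc⟩ := CuspForm.exists_smul_discriminant_of_weight_eq_twelve G
  have key (z : ℂ) (hz : 0 < z.im) : F z = c * η z ^ 24 := by
    have := DFunLike.congr_fun hc (⟨z, hz⟩ : ℍ)
    rw [η_eq_eta]
    exact this.symm
  have hcV : c = V 0 := by
    have h1 : Tendsto (fun y : ℝ ↦ c * eulerProd (nome (y * I) ^ 2) ^ 24) atTop
        (𝓝 (c * 1 ^ 24)) := by
      refine ((tendsto_eulerProd.comp ?_).pow 24).const_mul c
      simpa using tendsto_nome_atTop.pow 2
    have h2 := hV.tendsto.comp tendsto_nome_atTop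
    rw [one_pow, mul_one] at h1
    refine tendsto_nhds_unique (h1.congr' ?_) h2
    filter_upwards [eventually_gt_atTop 0] with y hy
    have hy' : 0 < (y * I : ℂ).im := by simpa using hy
    have h3 := (key _ hy').symm.trans (hF _ hy')
    rw [show 24 = 12 * 2 by norm_num, pow_mul, η_pow_twelve] at h3
    have h0 := pow_ne_zero 2 (nome_ne_zero (y * I))
    apply mul_left_cancel₀ h0
    rw [Function.comp_apply, ← h3]
    ring
  rw [key τ hτ, hcV]

lemma isOpen_im_pos : IsOpen {z : ℂ | 0 < z.im} := isOpen_lt continuous_const continuous_im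

lemma eventually_im_pos {τ : ℂ} (hτ : 0 < τ.im) : ∀ᶠ z in 𝓝 τ, 0 < z.im :=
  isOpen_im_pos.mem_nhds hτ

lemma analyticAt_thetaSeries {x : ℂ} (hx : ‖x‖ < 1) : AnalyticAt ℂ thetaSeries x :=
  differentiableOn_thetaSeries.analyticAt (Metric.isOpen_ball.mem_nhds (by simpa using hx))

lemma analyticAt_thetaSeries_neg {x : ℂ} (hx : ‖x‖ < 1) :
    AnalyticAt ℂ (fun x ↦ thetaSeries (-x)) x :=
  (analyticAt_thetaSeries (x := -x) (by simpa using hx)).comp (f := fun x ↦ -x) (by fun_prop)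

lemma analyticAt_psiSeries {x : ℂ} (hx : ‖x‖ < 1) : AnalyticAt ℂ psiSeries x :=
  differentiableOn_psiSeries.analyticAt (Metric.isOpen_ball.mem_nhds (by simpa using hx))

lemma differentiableAt_nome (τ : ℂ) : DifferentiableAt ℂ nome τ :=
  (hasDerivAt_nome τ).differentiableAt

lemma differentiableAt_θ₂ {τ : ℂ} (hτ : 0 < τ.im) : DifferentiableAt ℂ θ₂ τ := by
  have h : θ₂ =ᶠ[𝓝 τ] fun z ↦ cexp (Real.pi * I * z / 4) * (psiSeries ∘ nome) z := by
    filter_upwards [eventually_im_pos hτ] with z hz using θ₂_eq_psiSeries hz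
  have h1 := (analyticAt_psiSeries (norm_nome_lt_one hτ)).differentiableAt.comp τ
    (differentiableAt_nome τ)
  exact h.differentiableAt_iff.mpr (.mul (by fun_prop) h1)

lemma differentiableAt_θ₃ {τ : ℂ} (hτ : 0 < τ.im) : DifferentiableAt ℂ θ₃ τ := by
  have h : θ₃ =ᶠ[𝓝 τ] thetaSeries ∘ nome := by
    filter_upwards [eventually_im_pos hτ] with z hz using θ₃_eq_thetaSeries hz
  exact h.differentiableAt_iff.mpr
    ((analyticAt_thetaSeries (norm_nome_lt_one hτ)).differentiableAt.comp τ
      (differentiableAt_nome τ))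

lemma differentiableAt_θ₄ {τ : ℂ} (hτ : 0 < τ.im) : DifferentiableAt ℂ θ₄ τ := by
  have h : θ₄ =ᶠ[𝓝 τ] (fun x ↦ thetaSeries (-x)) ∘ nome := by
    filter_upwards [eventually_im_pos hτ] with z hz using θ₄_eq_thetaSeries hz
  exact h.differentiableAt_iff.mpr
    ((analyticAt_thetaSeries_neg (norm_nome_lt_one hτ)).differentiableAt.comp τ
      (differentiableAt_nome τ))

/-- The product of the three theta constants is `2 * η ^ 3`, up to an eighth root of unity. -/
lemma theta_mul_pow_eight {τ : ℂ} (hτ : 0 < τ.im) :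
    (θ₂ τ * θ₃ τ * θ₄ τ) ^ 8 = 2 ^ 8 * η τ ^ 24 := by
  have hV : ContinuousAt (fun x ↦ (psiSeries x * thetaSeries x * thetaSeries (-x)) ^ 8) 0 :=
    (((analyticAt_psiSeries (by simp)).mul (analyticAt_thetaSeries (by simp))).mul
      (analyticAt_thetaSeries_neg (by simp))).continuousAt.pow 8
  have := eq_const_mul_η_pow (F := fun τ ↦ (θ₂ τ * θ₃ τ * θ₄ τ) ^ 8) ?_ ?_ ?_ hV ?_ hτ
  · simpa [psiSeries_zero, thetaSeries_zero] using this
  · intro z hz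
    exact (((differentiableAt_θ₂ hz).mul (differentiableAt_θ₃ hz)).mul
      (differentiableAt_θ₄ hz)).pow 8
  · intro z hz
    have h8 : cexp (Real.pi * I / 4) ^ 8 = 1 := by
      rw [← Complex.exp_nat_mul, ← Complex.exp_two_pi_mul_I]
      congr 1
      push_cast
      ring
    simp only [θ₂_add_one hz, θ₃_add_one hz, θ₄_add_one hz, mul_pow, h8]
    ring
  · intro z hz
    simp only [θ₂_neg_one_div hz, θ₃_neg_one_div hz, θ₄_neg_one_div hz, ← thetaFactor_pow]
    ring
  · intro z hz
    have h8 : cexp (Real.pi * I * z / 4) ^ 8 = nome z ^ 2 := by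
      rw [nome, ← Complex.exp_nat_mul, ← Complex.exp_nat_mul]
      congr 1
      push_cast
      ring
    simp only [θ₂_eq_psiSeries hz, θ₃_eq_thetaSeries hz, θ₄_eq_thetaSeries hz, mul_pow, h8]
    ring

lemma theta_ne_zero {τ : ℂ} (hτ : 0 < τ.im) : (θ₂ τ ≠ 0 ∧ θ₃ τ ≠ 0) ∧ θ₄ τ ≠ 0 := by
  have h : (θ₂ τ * θ₃ τ * θ₄ τ) ^ 8 ≠ 0 := by
    rw [theta_mul_pow_eight hτ]
    exact mul_ne_zero (by norm_num) (pow_ne_zero _ (η_ne_zero hτ))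
  rwa [pow_ne_zero_iff (by norm_num), mul_ne_zero_iff, mul_ne_zero_iff] at h

lemma Filter.EventuallyEq.logDeriv_apply_eq {f g : ℂ → ℂ} {z : ℂ} (h : f =ᶠ[𝓝 z] g) :
    logDeriv f z = logDeriv g z := by
  rw [logDeriv_apply, logDeriv_apply, h.deriv_eq, h.eq_of_nhds]

lemma logDeriv_comp_nome {G : ℂ → ℂ} {τ : ℂ} (hG : DifferentiableAt ℂ G (nome τ)) :
    logDeriv (G ∘ nome) τ = Real.pi * I * (nome τ * logDeriv G (nome τ)) := by
  rw [logDeriv_comp hG (differentiableAt_nome τ), (hasDerivAt_nome τ).deriv]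
  ring

lemma logDeriv_θ₃ {τ : ℂ} (hτ : 0 < τ.im) :
    logDeriv θ₃ τ = Real.pi * I * (nome τ * logDeriv thetaSeries (nome τ)) := by
  rw [← logDeriv_comp_nome (analyticAt_thetaSeries (norm_nome_lt_one hτ)).differentiableAt]
  apply EventuallyEq.logDeriv_apply_eq
  filter_upwards [eventually_im_pos hτ] with z hz using θ₃_eq_thetaSeries hz

lemma logDeriv_θ₄ {τ : ℂ} (hτ : 0 < τ.im) :
    logDeriv θ₄ τ =
      Real.pi * I * (nome τ * logDeriv (fun x ↦ thetaSeries (-x)) (nome τ)) := by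
  rw [← logDeriv_comp_nome (analyticAt_thetaSeries_neg (norm_nome_lt_one hτ)).differentiableAt]
  apply EventuallyEq.logDeriv_apply_eq
  filter_upwards [eventually_im_pos hτ] with z hz using θ₄_eq_thetaSeries hz

lemma psiSeries_nome_ne_zero {τ : ℂ} (hτ : 0 < τ.im) : psiSeries (nome τ) ≠ 0 :=
  right_ne_zero_of_mul (θ₂_eq_psiSeries hτ ▸ (theta_ne_zero hτ).1.1)

lemma logDeriv_θ₂ {τ : ℂ} (hτ : 0 < τ.im) :
    logDeriv θ₂ τ = Real.pi * I * (1 / 4 + nome τ * logDeriv psiSeries (nome τ)) := by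
  have hd := (analyticAt_psiSeries (norm_nome_lt_one hτ)).differentiableAt
  have h : θ₂ =ᶠ[𝓝 τ] fun z ↦ cexp (Real.pi * I * z / 4) * (psiSeries ∘ nome) z := by
    filter_upwards [eventually_im_pos hτ] with z hz using θ₂_eq_psiSeries hz
  have he : logDeriv (fun z ↦ cexp (Real.pi * I * z / 4)) τ = Real.pi * I / 4 := by
    have := (((hasDerivAt_id τ).const_mul (Real.pi * I)).div_const 4).cexp.deriv
    simp only [id] at this
    rw [logDeriv_apply, this, mul_div_cancel_left₀ _ (Complex.exp_ne_zero _), mul_one]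
  rw [h.logDeriv_apply_eq, logDeriv_mul (f := fun z ↦ cexp (Real.pi * I * z / 4)) τ
    (Complex.exp_ne_zero _) (psiSeries_nome_ne_zero hτ) (by fun_prop)
    (hd.comp τ (differentiableAt_nome τ)), he, logDeriv_comp_nome hd]
  ring

/-- Transformation of logarithmic derivatives under a change of variable with a factor. -/
lemma logDeriv_mul_of_comp_eq {G H φ u : ℂ → ℂ} {φ' τ : ℂ} (hφ : HasDerivAt φ φ' τ)
    (hG : DifferentiableAt ℂ G (φ τ)) (hH : DifferentiableAt ℂ H τ)
    (hu : DifferentiableAt ℂ u τ) (hH0 : H τ ≠ 0) (hu0 : u τ ≠ 0)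
    (h : ∀ᶠ z in 𝓝 τ, G (φ z) = u z * H z) :
    logDeriv G (φ τ) * φ' = logDeriv u τ + logDeriv H τ := by
  rw [← logDeriv_mul τ hu0 hH0 hu hH, ← hφ.deriv, ← logDeriv_comp hG hφ.differentiableAt]
  exact EventuallyEq.logDeriv_apply_eq h

lemma hasDerivAt_neg_one_div {τ : ℂ} (hτ : 0 < τ.im) :
    HasDerivAt (fun z : ℂ ↦ -1 / z) (1 / τ ^ 2) τ := by
  have := (hasDerivAt_inv (ne_zero_of_im_pos hτ)).const_mul (-1)
  simpa [div_eq_mul_inv] using this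

lemma logDeriv_neg_one_div {G H : ℂ → ℂ} {τ : ℂ} (hτ : 0 < τ.im)
    (hG : DifferentiableAt ℂ G (-1 / τ)) (hH : DifferentiableAt ℂ H τ) (hH0 : H τ ≠ 0)
    (h : ∀ z : ℂ, 0 < z.im → G (-1 / z) = thetaFactor z * H z) :
    logDeriv G (-1 / τ) = τ ^ 2 * (logDeriv thetaFactor τ + logDeriv H τ) := by
  have := logDeriv_mul_of_comp_eq (hasDerivAt_neg_one_div hτ) hG hH
    (differentiableAt_thetaFactor hτ) hH0 (thetaFactor_ne_zero hτ)
    ((eventually_im_pos hτ).mono h)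
  rw [← this]
  have := ne_zero_of_im_pos hτ
  field_simp

lemma logDeriv_add_one {G H : ℂ → ℂ} {c τ : ℂ} (hτ : 0 < τ.im) (hc : c ≠ 0)
    (hG : DifferentiableAt ℂ G (τ + 1)) (hH : DifferentiableAt ℂ H τ) (hH0 : H τ ≠ 0)
    (h : ∀ z : ℂ, 0 < z.im → G (z + 1) = c * H z) :
    logDeriv G (τ + 1) = logDeriv H τ := by
  have := logDeriv_mul_of_comp_eq ((hasDerivAt_id τ).add_const 1) hG hH
    (differentiableAt_const c) hH0 hc ((eventually_im_pos hτ).mono h)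
  simpa using this

/-- The logarithmic derivative of `θ₂ / θ₃`. -/
noncomputable def logDeriv23 (τ : ℂ) : ℂ := logDeriv θ₂ τ - logDeriv θ₃ τ

/-- The logarithmic derivative of `θ₂ / θ₄`. -/
noncomputable def logDeriv24 (τ : ℂ) : ℂ := logDeriv θ₂ τ - logDeriv θ₄ τ

lemma logDeriv23_neg_one_div {τ : ℂ} (hτ : 0 < τ.im) :
    logDeriv23 (-1 / τ) = τ ^ 2 * (logDeriv23 τ - logDeriv24 τ) := by
  have hS := im_neg_one_div_pos hτ
  rw [logDeriv23, logDeriv23, logDeriv24,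
    logDeriv_neg_one_div hτ (differentiableAt_θ₂ hS) (differentiableAt_θ₄ hτ)
      (theta_ne_zero hτ).2 fun _ ↦ θ₂_neg_one_div,
    logDeriv_neg_one_div hτ (differentiableAt_θ₃ hS) (differentiableAt_θ₃ hτ)
      (theta_ne_zero hτ).1.2 fun _ ↦ θ₃_neg_one_div]
  ring

lemma logDeriv24_neg_one_div {τ : ℂ} (hτ : 0 < τ.im) :
    logDeriv24 (-1 / τ) = τ ^ 2 * -logDeriv24 τ := by
  have hS := im_neg_one_div_pos hτ
  rw [logDeriv24, logDeriv24,
    logDeriv_neg_one_div hτ (differentiableAt_θ₂ hS) (differentiableAt_θ₄ hτ)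
      (theta_ne_zero hτ).2 fun _ ↦ θ₂_neg_one_div,
    logDeriv_neg_one_div hτ (differentiableAt_θ₄ hS) (differentiableAt_θ₂ hτ)
      (theta_ne_zero hτ).1.1 fun _ ↦ θ₄_neg_one_div]
  ring

lemma logDeriv_θ₂_add_one {τ : ℂ} (hτ : 0 < τ.im) : logDeriv θ₂ (τ + 1) = logDeriv θ₂ τ :=
  logDeriv_add_one hτ (Complex.exp_ne_zero _) (differentiableAt_θ₂ (by simpa using hτ))
    (differentiableAt_θ₂ hτ) (theta_ne_zero hτ).1.1 fun _ ↦ θ₂_add_one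

lemma logDeriv23_add_one {τ : ℂ} (hτ : 0 < τ.im) : logDeriv23 (τ + 1) = logDeriv24 τ := by
  rw [logDeriv23, logDeriv24, logDeriv_θ₂_add_one hτ,
    logDeriv_add_one hτ one_ne_zero (differentiableAt_θ₃ (by simpa using hτ))
      (differentiableAt_θ₄ hτ) (theta_ne_zero hτ).2 fun z hz ↦ by rw [one_mul, θ₃_add_one hz]]

lemma logDeriv24_add_one {τ : ℂ} (hτ : 0 < τ.im) : logDeriv24 (τ + 1) = logDeriv23 τ := by
  rw [logDeriv23, logDeriv24, logDeriv_θ₂_add_one hτ,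
    logDeriv_add_one hτ one_ne_zero (differentiableAt_θ₄ (by simpa using hτ))
      (differentiableAt_θ₃ hτ) (theta_ne_zero hτ).1.2 fun z hz ↦ by rw [one_mul, θ₄_add_one hz]]

/-- The expansion of `logDeriv23 / (πi)` in the nome. -/
noncomputable def series23 (x : ℂ) : ℂ :=
  1 / 4 + x * logDeriv psiSeries x - x * logDeriv thetaSeries x

/-- The expansion of `logDeriv24 / (πi)` in the nome. -/
noncomputable def series24 (x : ℂ) : ℂ :=
  1 / 4 + x * logDeriv psiSeries x - x * logDeriv (fun x ↦ thetaSeries (-x)) x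

lemma logDeriv23_eq {τ : ℂ} (hτ : 0 < τ.im) :
    logDeriv23 τ = Real.pi * I * series23 (nome τ) := by
  rw [logDeriv23, logDeriv_θ₂ hτ, logDeriv_θ₃ hτ, series23]
  ring

lemma logDeriv24_eq {τ : ℂ} (hτ : 0 < τ.im) :
    logDeriv24 τ = Real.pi * I * series24 (nome τ) := by
  rw [logDeriv24, logDeriv_θ₂ hτ, logDeriv_θ₄ hτ, series24]
  ring

lemma AnalyticAt.logDeriv {G : ℂ → ℂ} {x : ℂ} (hG : AnalyticAt ℂ G x) (h0 : G x ≠ 0) :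
    AnalyticAt ℂ (logDeriv G) x :=
  hG.deriv.div hG h0

lemma analyticAt_series23 {x : ℂ} (hx : ‖x‖ < 1) (h2 : psiSeries x ≠ 0) (h3 : thetaSeries x ≠ 0) :
    AnalyticAt ℂ series23 x := by
  have h2' := (analyticAt_psiSeries hx).logDeriv h2
  have h3' := (analyticAt_thetaSeries hx).logDeriv h3
  unfold series23
  fun_prop

lemma analyticAt_series24 {x : ℂ} (hx : ‖x‖ < 1) (h2 : psiSeries x ≠ 0)
    (h4 : thetaSeries (-x) ≠ 0) : AnalyticAt ℂ series24 x := by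
  have h2' := (analyticAt_psiSeries hx).logDeriv h2
  have h4' := (analyticAt_thetaSeries_neg hx).logDeriv h4
  unfold series24
  fun_prop

lemma deriv_series_sub :
    deriv series24 0 - deriv series23 0 = 4 := by
  have key {G : ℂ → ℂ} (hG : AnalyticAt ℂ G 0) (h0 : G 0 ≠ 0) :
      HasDerivAt (fun x ↦ x * logDeriv G x) (logDeriv G 0) 0 := by
    simpa using (hasDerivAt_id (0 : ℂ)).fun_mul (hG.logDeriv h0).differentiableAt.hasDerivAt
  have h2 := key (analyticAt_psiSeries (by simp)) (by simp [psiSeries_zero])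
  have h3 := key (analyticAt_thetaSeries (by simp)) (by simp [thetaSeries_zero])
  have h4 := key (analyticAt_thetaSeries_neg (by simp)) (by simp [thetaSeries_zero])
  have e3 : deriv series23 0 = _ := ((h2.const_add (1 / 4)).sub h3).deriv
  have e4 : deriv series24 0 = _ := ((h2.const_add (1 / 4)).sub h4).deriv
  rw [e3, e4]
  simp only [logDeriv_apply, deriv_comp_neg, neg_zero, thetaSeries_zero, deriv_thetaSeries_zero]
  ring

/-- The Wronskian of `series23` and `series24`. -/
noncomputable def seriesWronskian (x : ℂ) : ℂ :=
  series23 x * deriv series24 x - series24 x * deriv series23 x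

lemma analyticAt_seriesWronskian {x : ℂ} (hx : ‖x‖ < 1) (h2 : psiSeries x ≠ 0)
    (h3 : thetaSeries x ≠ 0) (h4 : thetaSeries (-x) ≠ 0) : AnalyticAt ℂ seriesWronskian x := by
  have hA := analyticAt_series23 hx h2 h3
  have hB := analyticAt_series24 hx h2 h4
  exact (hA.mul hB.deriv).sub (hB.mul hA.deriv)

lemma seriesWronskian_zero : seriesWronskian 0 = 1 := by
  have := deriv_series_sub
  simp only [seriesWronskian, series23, series24, zero_mul, add_zero, sub_zero]
  linear_combination this / 4

lemma continuousAt_seriesWronskian_zero : ContinuousAt seriesWronskian 0 :=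
  (analyticAt_seriesWronskian (by simp) (by simp [psiSeries_zero]) (by simp [thetaSeries_zero])
    (by simp [thetaSeries_zero])).continuousAt

/-- The Wronskian of `logDeriv23` and `logDeriv24`. -/
noncomputable def thetaWronskian (τ : ℂ) : ℂ :=
  logDeriv23 τ * deriv logDeriv24 τ - logDeriv24 τ * deriv logDeriv23 τ

lemma hasDerivAt_logDeriv23 {τ : ℂ} (hτ : 0 < τ.im) : HasDerivAt logDeriv23
    (Real.pi * I * (deriv series23 (nome τ) * (Real.pi * I * nome τ))) τ := by
  have hA := (analyticAt_series23 (norm_nome_lt_one hτ) (psiSeries_nome_ne_zero hτ)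
    (θ₃_eq_thetaSeries hτ ▸ (theta_ne_zero hτ).1.2)).differentiableAt.hasDerivAt
  refine ((hA.comp τ (hasDerivAt_nome τ)).const_mul (Real.pi * I)).congr_of_eventuallyEq ?_
  filter_upwards [eventually_im_pos hτ] with z hz using logDeriv23_eq hz

lemma hasDerivAt_logDeriv24 {τ : ℂ} (hτ : 0 < τ.im) : HasDerivAt logDeriv24
    (Real.pi * I * (deriv series24 (nome τ) * (Real.pi * I * nome τ))) τ := by
  have hB := (analyticAt_series24 (norm_nome_lt_one hτ) (psiSeries_nome_ne_zero hτ)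
    (θ₄_eq_thetaSeries hτ ▸ (theta_ne_zero hτ).2)).differentiableAt.hasDerivAt
  refine ((hB.comp τ (hasDerivAt_nome τ)).const_mul (Real.pi * I)).congr_of_eventuallyEq ?_
  filter_upwards [eventually_im_pos hτ] with z hz using logDeriv24_eq hz

lemma thetaWronskian_eq {τ : ℂ} (hτ : 0 < τ.im) :
    thetaWronskian τ = (Real.pi * I) ^ 3 * (nome τ * seriesWronskian (nome τ)) := by
  rw [thetaWronskian, (hasDerivAt_logDeriv23 hτ).deriv, (hasDerivAt_logDeriv24 hτ).deriv,
    logDeriv23_eq hτ, logDeriv24_eq hτ, seriesWronskian]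
  ring

lemma differentiableAt_thetaWronskian {τ : ℂ} (hτ : 0 < τ.im) :
    DifferentiableAt ℂ thetaWronskian τ := by
  have hC := (analyticAt_seriesWronskian (norm_nome_lt_one hτ) (psiSeries_nome_ne_zero hτ)
    (θ₃_eq_thetaSeries hτ ▸ (theta_ne_zero hτ).1.2)
    (θ₄_eq_thetaSeries hτ ▸ (theta_ne_zero hτ).2)).differentiableAt.comp τ
      (differentiableAt_nome τ)
  refine (((differentiableAt_nome τ).mul hC).const_mul
    ((Real.pi * I) ^ 3)).congr_of_eventuallyEq ?_
  filter_upwards [eventually_im_pos hτ] with z hz using thetaWronskian_eq hz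

lemma thetaWronskian_add_one {τ : ℂ} (hτ : 0 < τ.im) :
    thetaWronskian (τ + 1) = -thetaWronskian τ := by
  have e3 : deriv logDeriv23 (τ + 1) = deriv logDeriv24 τ := by
    rw [← deriv_comp_add_const]
    exact EventuallyEq.deriv_eq ((eventually_im_pos hτ).mono fun z ↦ logDeriv23_add_one)
  have e4 : deriv logDeriv24 (τ + 1) = deriv logDeriv23 τ := by
    rw [← deriv_comp_add_const]
    exact EventuallyEq.deriv_eq ((eventually_im_pos hτ).mono fun z ↦ logDeriv24_add_one)
  rw [thetaWronskian, e3, e4, logDeriv23_add_one hτ, logDeriv24_add_one hτ, thetaWronskian]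
  ring

lemma deriv_neg_one_div_eq {f g : ℂ → ℂ} {τ : ℂ} (hτ : 0 < τ.im)
    (hf : DifferentiableAt ℂ f (-1 / τ))
    (hg : DifferentiableAt ℂ g τ) (h : ∀ z : ℂ, 0 < z.im → f (-1 / z) = z ^ 2 * g z) :
    deriv f (-1 / τ) = τ ^ 2 * (2 * τ * g τ + τ ^ 2 * deriv g τ) := by
  have h1 := (hf.hasDerivAt.comp τ (hasDerivAt_neg_one_div hτ)).deriv
  have h2 := (((hasDerivAt_id τ).fun_pow 2).fun_mul hg.hasDerivAt).deriv
  have h3 : deriv (f ∘ fun z ↦ -1 / z) τ = deriv (fun z ↦ z ^ 2 * g z) τ :=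
    EventuallyEq.deriv_eq ((eventually_im_pos hτ).mono h)
  have h4 := h1.symm.trans (h3.trans h2)
  have h0 := ne_zero_of_im_pos hτ
  simp only [id] at h4
  have h5 : deriv f (-1 / τ) = τ ^ 2 * (deriv f (-1 / τ) * (1 / τ ^ 2)) := by field_simp
  rw [h5, h4]
  push_cast
  ring

lemma thetaWronskian_neg_one_div {τ : ℂ} (hτ : 0 < τ.im) :
    thetaWronskian (-1 / τ) = -τ ^ 6 * thetaWronskian τ := by
  have hS := im_neg_one_div_pos hτ
  have d3 := (hasDerivAt_logDeriv23 hτ).differentiableAt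
  have d4 := (hasDerivAt_logDeriv24 hτ).differentiableAt
  rw [thetaWronskian,
    deriv_neg_one_div_eq hτ (hasDerivAt_logDeriv23 hS).differentiableAt (d3.fun_sub d4)
      fun _ ↦ logDeriv23_neg_one_div,
    deriv_neg_one_div_eq hτ (hasDerivAt_logDeriv24 hS).differentiableAt d4.fun_neg
      fun _ ↦ logDeriv24_neg_one_div,
    deriv_fun_sub d3 d4, deriv.fun_neg, logDeriv23_neg_one_div hτ, logDeriv24_neg_one_div hτ,
    thetaWronskian]
  ring

lemma thetaWronskian_sq {τ : ℂ} (hτ : 0 < τ.im) :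
    thetaWronskian τ ^ 2 = ((Real.pi * I) ^ 3 * η τ ^ 12) ^ 2 := by
  have hV : ContinuousAt (fun x ↦ ((Real.pi * I) ^ 3 * seriesWronskian x) ^ 2) 0 :=
    (continuousAt_seriesWronskian_zero.const_mul _).pow 2
  have := eq_const_mul_η_pow (F := fun τ ↦ thetaWronskian τ ^ 2)
    (fun z hz ↦ (differentiableAt_thetaWronskian hz).pow 2)
    (fun z hz ↦ by simp only [thetaWronskian_add_one hz, neg_sq])
    (fun z hz ↦ by simp only [thetaWronskian_neg_one_div hz]; ring) hV
    (fun z hz ↦ by simp only [thetaWronskian_eq hz]; ring) hτ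
  simp only [seriesWronskian_zero] at this
  rw [this]
  ring

lemma thetaWronskian_eq_η_pow {τ : ℂ} (hτ : 0 < τ.im) :
    thetaWronskian τ = (Real.pi * I) ^ 3 * η τ ^ 12 := by
  have hpi : (Real.pi * I : ℂ) ^ 3 ≠ 0 := by simp [Real.pi_ne_zero]
  have hη : ContinuousOn (fun z ↦ (Real.pi * I) ^ 3 * η z ^ 12) {z | 0 < z.im} := by
    simp only [η_eq_eta]
    exact fun z hz ↦ (((ModularForm.differentiableAt_eta_of_mem_upperHalfPlaneSet
      hz).continuousAt.pow 12).const_mul _).continuousWithinAt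
  rcases (convex_halfSpace_im_gt 0).isPreconnected.eq_or_eq_neg_of_sq_eq
    (fun z hz ↦ (differentiableAt_thetaWronskian hz).continuousAt.continuousWithinAt) hη
    (fun z hz ↦ thetaWronskian_sq hz)
    (fun hz ↦ mul_ne_zero hpi (pow_ne_zero _ (η_ne_zero hz))) with h | h
  · exact h hτ
  · exfalso
    have h1 := continuousAt_seriesWronskian_zero.tendsto.comp tendsto_nome_atTop
    have h2 : Tendsto (fun y : ℝ ↦ -eulerProd (nome (y * I) ^ 2) ^ 12) atTop (𝓝 (-1 ^ 12)) := by
      refine ((tendsto_eulerProd.comp ?_).pow 12).neg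
      simpa using tendsto_nome_atTop.pow 2
    have h3 := tendsto_nhds_unique (h1.congr' ?_) h2
    · rw [seriesWronskian_zero] at h3
      norm_num at h3
    · filter_upwards [eventually_gt_atTop 0] with y hy
      have hy' : 0 < (y * I : ℂ).im := by simpa using hy
      have h4 := h hy'
      rw [thetaWronskian_eq hy', Pi.neg_apply, η_pow_twelve] at h4
      apply mul_left_cancel₀ (mul_ne_zero hpi (nome_ne_zero (y * I)))
      rw [Function.comp_apply]
      linear_combination h4

/-- The Wronskian identity `h₀ ∂₂h₁ - h₁ ∂₂h₀ = 4η¹²` on `ℍ`. -/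
theorem wronskian_characters (τ : ℂ) (hτ : 0 < τ.im) :
    h₀ τ * partialD 2 h₁ τ - h₁ τ * partialD 2 h₀ τ = 4 * η τ ^ 12 := by
  have hpi : (Real.pi : ℂ) ≠ 0 := by simp [Real.pi_ne_zero]
  have e0 : h₀ = fun z ↦ 2 / (Real.pi * I) * (logDeriv23 z + logDeriv24 z) := by
    ext z
    simp only [h₀, ξ₂, ξ₃, ξ₄, Dq, logDeriv23, logDeriv24, logDeriv_apply]
    field_simp
    ring
  have e1 : h₁ = fun z ↦ 2 / (Real.pi * I) * (logDeriv24 z - logDeriv23 z) := by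
    ext z
    simp only [h₁, ξ₃, ξ₄, Dq, logDeriv23, logDeriv24, logDeriv_apply]
    field_simp
    ring
  have d3 := (hasDerivAt_logDeriv23 hτ).differentiableAt
  have d4 := (hasDerivAt_logDeriv24 hτ).differentiableAt
  have D0 : deriv h₀ τ = 2 / (Real.pi * I) * (deriv logDeriv23 τ + deriv logDeriv24 τ) := by
    rw [e0, deriv_const_mul_field, deriv_fun_add d3 d4]
  have D1 : deriv h₁ τ = 2 / (Real.pi * I) * (deriv logDeriv24 τ - deriv logDeriv23 τ) := by
    rw [e1, deriv_const_mul_field, deriv_fun_sub d4 d3]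
  have hW := thetaWronskian_eq_η_pow hτ
  rw [thetaWronskian] at hW
  have hη : η τ ^ 12 = (logDeriv23 τ * deriv logDeriv24 τ - logDeriv24 τ * deriv logDeriv23 τ) /
      (Real.pi * I) ^ 3 := by
    rw [hW, mul_div_cancel_left₀]
    simp [Real.pi_ne_zero]
  rw [hη, partialD, partialD, Dq, Dq, D0, D1, e0, e1]
  field_simp
  ring
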